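/- Let n ≥ p ≥ 1. The pushforward of Lebesgue measure on the space of n×p complex matrices X (a real vector space of dimension 2np) under the map X ↦ S = X* X equals the measure on Herm(p) that has density S ↦ (π^{np} / Γ̃_p(n)) · det(S)^{n-p} · 1_{S > 0} with respect to the Lebesgue measure μ_p on Herm(p), where 1_{S>0} is the indicator of the cone of positive definite matrices. -/

import Mathlib

open MeasureTheory Matrix
open scoped ComplexOrder

noncomputable section

/-- Parameter space `ℝ^p × ℂ^{p(p-1)/2}` for `p × p` Hermitian matrices:
the real diagonal entries together with the strictly upper-triangular complex entries. -/
abbrev HermParam (p : ℕ) : Type :=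
  (Fin p → ℝ) × ({ q : Fin p × Fin p // q.1 < q.2 } → ℂ)

/-- The linear isomorphism sending the parameters to the corresponding self-adjoint matrix. -/
def toHermMatrix (p : ℕ) (T : HermParam p) : Matrix (Fin p) (Fin p) ℂ :=
  Matrix.of fun i j =>
    if h : i < j then T.2 ⟨(i, j), h⟩
    else if h' : j < i then (starRingEnd ℂ) (T.2 ⟨(j, i), h'⟩)
    else (T.1 i : ℂ)

noncomputable instance matrixComplexMeasureSpace (m n : ℕ) :
    MeasureSpace (Matrix (Fin m) (Fin n) ℂ) :=
  inferInstanceAs (MeasureSpace (Fin m → Fin n → ℂ))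

/-- The Lebesgue measure `μ_p` on Herm(p), realized as a measure on the space of
`p × p` complex matrices: the pushforward of Lebesgue measure on the parameter space
under the linear isomorphism `toHermMatrix p`. -/
def hermLebesgue (p : ℕ) : Measure (Matrix (Fin p) (Fin p) ℂ) :=
  Measure.map (toHermMatrix p) volume

/-- The complex matrix-variate gamma function
`Γ̃_p(α) = π^{p(p-1)/2} ∏_{j=1}^p Γ(α - j + 1) = π^{p(p-1)/2} ∏_{j=0}^{p-1} Γ(α - j)`. -/
def cGammaP (p : ℕ) (α : ℂ) : ℂ :=
  (Real.pi : ℂ) ^ (p * (p - 1) / 2) * ∏ j : Fin p, Complex.Gamma (α - j)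

end

/-- The real-valued matrix-variate gamma function, for real arguments. -/
noncomputable def rGammaP (p : ℕ) (α : ℝ) : ℝ :=
  Real.pi ^ (p * (p - 1) / 2) * ∏ j : Fin p, Real.Gamma (α - j)

theorem Measure.ext_of_Iic_of_ne_top (μ ν : Measure ℝ) (hμ : ∀ t, μ (Set.Iic t) ≠ ⊤)
    (h : ∀ t, μ (Set.Iic t) = ν (Set.Iic t)) : μ = ν := by
  refine Measure.ext_of_Ioc' μ ν
    (fun a b _ => ne_top_of_le_ne_top (hμ b) (measure_mono fun x hx => hx.2)) fun a b hab => ?_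
  rw [← Set.Iic_sdiff_Iic, measure_sdiff (Set.Iic_subset_Iic.2 hab.le) measurableSet_Iic.nullMeasurableSet
    (hμ a), measure_sdiff (Set.Iic_subset_Iic.2 hab.le) measurableSet_Iic.nullMeasurableSet
    (h a ▸ hμ a), h, h]

theorem volume_sum_norm_sq_le (n : ℕ) (t : ℝ) :
    volume {x : Fin (n + 1) → ℂ | ∑ i, ‖x i‖ ^ 2 ≤ t} =
      ENNReal.ofReal (Real.pi ^ (n + 1) / (n + 1).factorial * (max t 0) ^ (n + 1)) := by
  rcases lt_or_ge t 0 with ht | ht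
  · have : {x : Fin (n + 1) → ℂ | ∑ i, ‖x i‖ ^ 2 ≤ t} = ∅ := by
      ext x
      simp only [Set.mem_ofPred_eq, Set.mem_empty_iff_false, iff_false, not_le]
      exact ht.trans_le (Finset.sum_nonneg fun i _ => by positivity)
    simp [this, max_eq_right ht.le]
  · have h := Complex.volume_sum_rpow_le (ι := Fin (n + 1)) (p := 2) (by norm_num) (Real.sqrt t)
    have hset : {x : Fin (n + 1) → ℂ | ∑ i, ‖x i‖ ^ 2 ≤ t} =
        {x | (∑ i, ‖x i‖ ^ (2 : ℝ)) ^ (1 / 2 : ℝ) ≤ Real.sqrt t} := by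
      ext x
      have : 0 ≤ ∑ i, ‖x i‖ ^ 2 := Finset.sum_nonneg fun i _ => by positivity
      simp only [Set.mem_ofPred_eq, Real.rpow_two, ← Real.sqrt_eq_rpow]
      exact (Real.sqrt_le_sqrt_iff ht).symm
    rw [hset, h, max_eq_left ht, ← ENNReal.ofReal_pow (Real.sqrt_nonneg t),
      ← ENNReal.ofReal_mul (by positivity), pow_mul, Real.sq_sqrt ht]
    congr 1
    have h1 : Real.Gamma (2 / 2 + 1) = 1 := by norm_num
    have h2 : Real.Gamma (2 * (Fintype.card (Fin (n + 1)) : ℕ) / 2 + 1) = (n + 1).factorial := by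
      rw [← Real.Gamma_nat_eq_factorial]; congr 1; simp
    rw [h1, h2]
    simp [mul_comm]

theorem lintegral_comp_sum_norm_sq (n : ℕ) {g : ℝ → ENNReal} (hg : Measurable g) :
    ∫⁻ x : Fin (n + 1) → ℂ, g (∑ i, ‖x i‖ ^ 2) =
      ENNReal.ofReal (Real.pi ^ (n + 1) / n.factorial) *
        ∫⁻ s in Set.Ioi (0 : ℝ), ENNReal.ofReal (s ^ n) * g s := by
  have hN : Measurable fun x : Fin (n + 1) → ℂ => ∑ i, ‖x i‖ ^ 2 := by fun_prop
  have hd : Measurable fun s : ℝ => ENNReal.ofReal (s ^ n) := by fun_prop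
  have key : Measure.map (fun x : Fin (n + 1) → ℂ => ∑ i, ‖x i‖ ^ 2) volume =
      ENNReal.ofReal (Real.pi ^ (n + 1) / n.factorial) •
        (volume.restrict (Set.Ioi (0 : ℝ))).withDensity fun s => ENNReal.ofReal (s ^ n) := by
    have hI (t : ℝ) := Measure.map_apply (μ := volume) hN (measurableSet_Iic (a := t))
    have hI' (t : ℝ) := (hI t).trans (volume_sum_norm_sq_le n t)
    refine Measure.ext_of_Iic_of_ne_top _ _ (fun t => by rw [hI']; simp) fun t => ?_
    rw [hI', Measure.smul_apply, withDensity_apply _ measurableSet_Iic,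
      Measure.restrict_restrict measurableSet_Iic, Set.inter_comm, Set.Ioi_inter_Iic, smul_eq_mul]
    have hIoc : Set.Ioc 0 t = Set.Ioc 0 (max t 0) := by
      rcases le_total t 0 with h | h
      · simp [h]
      · simp [h]
    rw [hIoc, ← ofReal_integral_eq_lintegral_ofReal, ← ENNReal.ofReal_mul (by positivity),
      ← intervalIntegral.integral_of_le (le_max_right _ _), integral_pow]
    · congr 1
      rw [Nat.factorial_succ]
      push_cast
      field_simp
      simp
    · exact ((continuous_pow n).integrableOn_Icc (μ := volume)).mono_set Set.Ioc_subset_Icc_self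
    · filter_upwards [self_mem_ae_restrict measurableSet_Ioc] with s hs
      exact pow_nonneg hs.1.le _
  rw [← lintegral_map hg hN, key, lintegral_smul_measure, smul_eq_mul,
    lintegral_withDensity_eq_lintegral_mul _ hd hg]
  rfl

theorem exists_unitary_mulVec_single (n : ℕ) (x : Fin (n + 1) → ℂ) :
    ∃ U : Matrix (Fin (n + 1)) (Fin (n + 1)) ℂ, Uᴴ * U = 1 ∧
      U *ᵥ Pi.single 0 ((Real.sqrt (∑ i, ‖x i‖ ^ 2) : ℝ) : ℂ) = x := by
  set e : EuclideanSpace ℂ (Fin (n + 1)) := WithLp.toLp 2 x with he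
  have hnorm : ‖e‖ = Real.sqrt (∑ i, ‖x i‖ ^ 2) := by
    simp [EuclideanSpace.norm_eq, he]
  rw [← hnorm]
  rcases eq_or_ne e 0 with h0 | h0
  · refine ⟨1, by simp, ?_⟩
    have : x = 0 := by simpa [he] using h0
    simp [h0, this]
  · let v : Fin (n + 1) → EuclideanSpace ℂ (Fin (n + 1)) := fun _ => ((‖e‖ : ℂ)⁻¹) • e
    have hv : Orthonormal ℂ (({0} : Set (Fin (n + 1))).domRestrict v) := by
      rw [orthonormal_iff_ite]
      rintro ⟨i, rfl⟩ ⟨j, rfl⟩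
      have h1 : (‖e‖ : ℂ) ≠ 0 := by simpa using h0
      change inner ℂ (((‖e‖ : ℂ)⁻¹) • e) (((‖e‖ : ℂ)⁻¹) • e) = _
      rw [inner_smul_left, inner_smul_right, inner_self_eq_norm_sq_to_K]
      simp
      field_simp
    obtain ⟨b, hb⟩ := hv.exists_orthonormalBasis_extension_of_card_eq (by simp)
    refine ⟨Matrix.of fun i j => b j i, ?_, ?_⟩
    · ext i j
      have := orthonormal_iff_ite.1 b.orthonormal i j
      rw [Matrix.one_apply, ← this, PiLp.inner_apply]
      simp [Matrix.mul_apply, mul_comm]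
    · ext i
      have := congrArg (fun w : EuclideanSpace ℂ (Fin (n + 1)) => w i) (hb 0 rfl)
      simp [v] at this
      have h1 : (‖e‖ : ℂ) ≠ 0 := by simpa using h0
      have h2 : e i = x i := rfl
      rw [Matrix.mulVec_single, Pi.smul_apply]
      simp [this, h2]
      field_simp

theorem sum_norm_sq_unitary_mul {n p : ℕ} {U : Matrix (Fin n) (Fin n) ℂ} (hU : Uᴴ * U = 1)
    (Y : Matrix (Fin n) (Fin p) ℂ) :
    ∑ i, ∑ j, ‖(U * Y) i j‖ ^ 2 = ∑ i, ∑ j, ‖Y i j‖ ^ 2 := by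
  have aux (Z : Matrix (Fin n) (Fin p) ℂ) :
      ((∑ i, ∑ j, ‖Z i j‖ ^ 2 : ℝ) : ℂ) = (Zᴴ * Z).trace := by
    simp only [Matrix.trace, Matrix.diag, Matrix.mul_apply, Matrix.conjTranspose_apply]
    rw [Finset.sum_comm]
    push_cast
    simp [Complex.conj_mul']
  apply Complex.ofReal_injective
  rw [aux, aux, conjTranspose_mul, Matrix.mul_assoc, ← Matrix.mul_assoc Uᴴ, hU, Matrix.one_mul]

theorem isAddHaarMeasure_volume_pi_pi (n p : ℕ) :
    (volume : Measure (Fin n → Fin p → ℂ)).IsAddHaarMeasure := by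
  have (i : Fin n) : ((fun _ => volume : Fin n → Measure (Fin p → ℂ)) i).IsAddHaarMeasure :=
    (inferInstance : (volume : Measure (Fin p → ℂ)).IsAddHaarMeasure)
  exact Measure.pi.isAddHaarMeasure fun _ => volume

theorem measurePreserving_unitary_mul {n p : ℕ} {U : Matrix (Fin n) (Fin n) ℂ}
    (hU : Uᴴ * U = 1) :
    MeasurePreserving (fun Y : Fin n → Fin p → ℂ => (U * Matrix.of Y : Matrix _ _ ℂ))
      (volume : Measure (Fin n → Fin p → ℂ)) (volume : Measure (Fin n → Fin p → ℂ)) := by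
  let L : (Fin n → Fin p → ℂ) →ₗ[ℝ] (Fin n → Fin p → ℂ) :=
    { toFun := fun Y => (U * Matrix.of Y : Matrix _ _ ℂ)
      map_add' := fun Y Z => Matrix.mul_add U (Matrix.of Y) (Matrix.of Z)
      map_smul' := fun c Y => Matrix.mul_smul U c (Matrix.of Y) }
  have hLc : Continuous L := L.continuous_of_finiteDimensional
  have hdet : LinearMap.det L ≠ 0 := by
    refine (LinearEquiv.isUnit_det' (LinearEquiv.ofInjectiveEndo L ?_)).ne_zero
    intro Y Z hYZ
    have : Uᴴ * (U * Matrix.of Y) = Uᴴ * (U * Matrix.of Z) := congrArg (Uᴴ * ·) hYZ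
    simpa [← Matrix.mul_assoc, hU] using this
  have := isAddHaarMeasure_volume_pi_pi n p
  have hmap := Measure.map_linearMap_addHaar_eq_smul_addHaar
    (volume : Measure (Fin n → Fin p → ℂ)) hdet
  let B : Set (Fin n → Fin p → ℂ) := {Y | ∑ i, ∑ j, ‖Y i j‖ ^ 2 < 1}
  have hBo : IsOpen B := isOpen_lt (by fun_prop) continuous_const
  have hB0 : volume B ≠ 0 := (hBo.measure_pos volume ⟨0, by simp [B]⟩).ne'
  have hBt : volume B ≠ ⊤ := by
    refine ((Metric.isBounded_closedBall (x := (0 : Fin n → Fin p → ℂ)) (r := 1)).subset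
      fun Y hY => ?_).measure_lt_top.ne
    rw [mem_closedBall_zero_iff, pi_norm_le_iff_of_nonneg zero_le_one]
    intro i
    rw [pi_norm_le_iff_of_nonneg zero_le_one]
    intro j
    have h1 : ‖Y i j‖ ^ 2 ≤ ∑ j, ‖Y i j‖ ^ 2 :=
      Finset.single_le_sum (f := fun j => ‖Y i j‖ ^ 2) (fun _ _ => by positivity) (Finset.mem_univ j)
    have h2 : ∑ j, ‖Y i j‖ ^ 2 ≤ ∑ i, ∑ j, ‖Y i j‖ ^ 2 :=
      Finset.single_le_sum (f := fun i => ∑ j, ‖Y i j‖ ^ 2)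
        (fun _ _ => Finset.sum_nonneg fun _ _ => by positivity) (Finset.mem_univ i)
    have h3 : ∑ i, ∑ j, ‖Y i j‖ ^ 2 < 1 := hY
    nlinarith [norm_nonneg (Y i j)]
  have hpre : L ⁻¹' B = B := by
    ext Y
    exact iff_of_eq (congrArg (· < (1 : ℝ)) (sum_norm_sq_unitary_mul hU (Matrix.of Y)))
  have hc : ENNReal.ofReal |(LinearMap.det L)⁻¹| = 1 := by
    have := congrArg (fun μ => μ B) hmap
    simp only [Measure.map_apply hLc.measurable hBo.measurableSet, hpre, Measure.smul_apply,
      smul_eq_mul] at this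
    exact (ENNReal.mul_eq_right hB0 hBt).1 this.symm
  exact ⟨hLc.measurable, by rw [hc, one_smul] at hmap; exact hmap⟩

/-- The Hermitian matrix with first diagonal entry `s`, remaining first row `v`, and lower right
block `W`. -/
def borderedMatrix {p : ℕ} (s : ℝ) (v : Fin p → ℂ) (W : Matrix (Fin p) (Fin p) ℂ) :
    Matrix (Fin (p + 1)) (Fin (p + 1)) ℂ :=
  Matrix.of (Fin.cons (Fin.cons (s : ℂ) v) fun i => Fin.cons (star (v i)) (W i))

section borderedMatrix

variable {p : ℕ} (s : ℝ) (v : Fin p → ℂ) (W : Matrix (Fin p) (Fin p) ℂ)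

@[simp]
theorem borderedMatrix_zero_zero : borderedMatrix s v W 0 0 = s := rfl

@[simp]
theorem borderedMatrix_zero_succ (j : Fin p) : borderedMatrix s v W 0 j.succ = v j := rfl

@[simp]
theorem borderedMatrix_succ_zero (i : Fin p) : borderedMatrix s v W i.succ 0 = star (v i) := rfl

@[simp]
theorem borderedMatrix_succ_succ (i j : Fin p) : borderedMatrix s v W i.succ j.succ = W i j := rfl

end borderedMatrix

/-- The rank one matrix `v* v` of a row vector `v`. -/
def rankOne {p : ℕ} (v : Fin p → ℂ) : Matrix (Fin p) (Fin p) ℂ :=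
  Matrix.of fun i j => star (v i) * v j

theorem conjTranspose_mul_cons_row {n p : ℕ} (y : Fin p → ℂ) (Z : Fin n → Fin p → ℂ) :
    (Matrix.of (Fin.cons y Z : Fin (n + 1) → Fin p → ℂ))ᴴ * Matrix.of (Fin.cons y Z) =
      rankOne y + (Matrix.of Z)ᴴ * Matrix.of Z := by
  ext i j
  simp [Matrix.mul_apply, Fin.sum_univ_succ, rankOne]

theorem conjTranspose_mul_cons_col {n p : ℕ} (x : Fin n → ℂ) (Y : Fin n → Fin p → ℂ) :
    (Matrix.of fun i => (Fin.cons (x i) (Y i) : Fin (p + 1) → ℂ))ᴴ *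
        Matrix.of (fun i => Fin.cons (x i) (Y i)) =
      borderedMatrix (∑ i, ‖x i‖ ^ 2) (star x ᵥ* Matrix.of Y) ((Matrix.of Y)ᴴ * Matrix.of Y) := by
  ext i j
  refine Fin.cases ?_ (fun i => ?_) i <;> refine Fin.cases ?_ (fun j => ?_) j <;>
    simp [Matrix.mul_apply, Matrix.vecMul, dotProduct, Complex.mul_conj', mul_comm]

theorem conjTranspose_mul_cons_col_unitary {n p : ℕ} {U : Matrix (Fin (n + 1)) (Fin (n + 1)) ℂ}
    (hU : Uᴴ * U = 1) {x : Fin (n + 1) → ℂ} {r : ℝ} (hx : U *ᵥ Pi.single 0 (r : ℂ) = x)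
    (y : Fin p → ℂ) (Z : Fin n → Fin p → ℂ) :
    borderedMatrix (∑ i, ‖x i‖ ^ 2)
        (star x ᵥ* (U * Matrix.of (Fin.cons y Z : Fin (n + 1) → Fin p → ℂ)))
        ((U * Matrix.of (Fin.cons y Z : Fin (n + 1) → Fin p → ℂ))ᴴ * (U * Matrix.of (Fin.cons y Z)))
      = borderedMatrix (∑ i, ‖x i‖ ^ 2) (r • y) (rankOne y + (Matrix.of Z)ᴴ * Matrix.of Z) := by
  have h1 : star x ᵥ* (U * Matrix.of (Fin.cons y Z : Fin (n + 1) → Fin p → ℂ)) = r • y := by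
    rw [← hx, Matrix.star_mulVec, Matrix.vecMul_vecMul, ← Matrix.mul_assoc, hU, Matrix.one_mul]
    ext j
    simp [Matrix.vecMul, dotProduct, Fin.sum_univ_succ]
  rw [h1, conjTranspose_mul, Matrix.mul_assoc, ← Matrix.mul_assoc Uᴴ, hU, Matrix.one_mul,
    conjTranspose_mul_cons_row]

/-- The unipotent upper triangular matrix with first row `(1, w)`. -/
def unipotentRow {p : ℕ} (w : Fin p → ℂ) : Matrix (Fin (p + 1)) (Fin (p + 1)) ℂ :=
  Matrix.of (Fin.cons (Fin.cons 1 w) fun i => Fin.cons 0 (Pi.single i 1))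

theorem det_unipotentRow {p : ℕ} (w : Fin p → ℂ) : (unipotentRow w).det = 1 := by
  have : (unipotentRow w).submatrix Fin.succ Fin.succ = 1 := by
    ext i j
    simp [unipotentRow, Matrix.one_apply, Pi.single_apply, eq_comm]
  rw [Matrix.det_succ_column_zero, Fin.sum_univ_succ]
  rw [Fin.succAbove_zero, this]
  simp [unipotentRow]

theorem det_borderedMatrix_zero {p : ℕ} (s : ℝ) (W : Matrix (Fin p) (Fin p) ℂ) :
    (borderedMatrix s 0 W).det = s * W.det := by
  have : (borderedMatrix s 0 W).submatrix Fin.succ Fin.succ = W := rfl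
  rw [Matrix.det_succ_column_zero, Fin.sum_univ_succ]
  rw [Fin.succAbove_zero, this]
  simp

theorem posDef_borderedMatrix_zero {p : ℕ} {s : ℝ} (hs : 0 < s) (W : Matrix (Fin p) (Fin p) ℂ) :
    (borderedMatrix s 0 W).PosDef ↔ W.PosDef := by
  refine ⟨fun h => h.submatrix (e := Fin.succ) (Fin.succ_injective p), fun h => ?_⟩
  refine .of_dotProduct_mulVec_pos ?_ fun x hx => ?_
  · ext i j
    refine Fin.cases ?_ (fun i => ?_) i <;> refine Fin.cases ?_ (fun j => ?_) j
    · simp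
    · simp
    · simp
    · exact congrFun (congrFun h.isHermitian i) j
  · have hsplit : star x ⬝ᵥ borderedMatrix s 0 W *ᵥ x =
        ((s * ‖x 0‖ ^ 2 : ℝ) : ℂ) + star (fun i => x (Fin.succ i)) ⬝ᵥ W *ᵥ fun i => x (Fin.succ i) := by
      simp only [dotProduct, Matrix.mulVec, Fin.sum_univ_succ, borderedMatrix_zero_zero,
        borderedMatrix_zero_succ, borderedMatrix_succ_zero, borderedMatrix_succ_succ]
      simp [← Complex.conj_mul']
      ring
    rw [hsplit]
    by_cases hx' : (fun i => x (Fin.succ i)) = 0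
    · have h0 : x 0 ≠ 0 := fun h0 => hx <| by
        ext i
        refine Fin.cases h0 (fun i => congrFun hx' i) i
      rw [hx']
      have : 0 < ‖x 0‖ := norm_pos_iff.2 h0
      simp only [star_zero, zero_dotProduct, add_zero]
      exact_mod_cast (by positivity : 0 < s * ‖x 0‖ ^ 2)
    · refine add_pos_of_nonneg_of_pos ?_ (h.dotProduct_mulVec_pos hx')
      exact_mod_cast (by positivity : 0 ≤ s * ‖x 0‖ ^ 2)

theorem borderedMatrix_eq_conj {p : ℕ} {s : ℝ} (hs : s ≠ 0) (v : Fin p → ℂ)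
    (W : Matrix (Fin p) (Fin p) ℂ) :
    borderedMatrix s v (s⁻¹ • rankOne v + W) =
      star (unipotentRow (s⁻¹ • v)) * borderedMatrix s 0 W * unipotentRow (s⁻¹ • v) := by
  have hs' : (s : ℂ) ≠ 0 := by exact_mod_cast hs
  ext i j
  refine Fin.cases ?_ (fun i => ?_) i <;> refine Fin.cases ?_ (fun j => ?_) j <;>
    simp [Matrix.mul_apply, Fin.sum_univ_succ, unipotentRow, rankOne, Pi.single_apply, hs',
      Matrix.star_apply, apply_ite] <;> field_simp

theorem det_borderedMatrix {p : ℕ} {s : ℝ} (hs : s ≠ 0) (v : Fin p → ℂ)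
    (W : Matrix (Fin p) (Fin p) ℂ) :
    (borderedMatrix s v (s⁻¹ • rankOne v + W)).det = s * W.det := by
  rw [borderedMatrix_eq_conj hs, det_mul, det_mul, star_eq_conjTranspose, det_conjTranspose,
    det_unipotentRow, det_borderedMatrix_zero]
  simp

theorem posDef_borderedMatrix {p : ℕ} {s : ℝ} (hs : 0 < s) (v : Fin p → ℂ)
    (W : Matrix (Fin p) (Fin p) ℂ) :
    (borderedMatrix s v (s⁻¹ • rankOne v + W)).PosDef ↔ W.PosDef := by
  rw [borderedMatrix_eq_conj hs.ne', Matrix.IsUnit.posDef_star_left_conjugate_iff,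
    posDef_borderedMatrix_zero hs]
  simp [Matrix.isUnit_iff_isUnit_det, det_unipotentRow]

theorem measurable_matrix_iff {α : Type*} [MeasurableSpace α] {m n : ℕ}
    {f : α → Matrix (Fin m) (Fin n) ℂ} :
    Measurable f ↔ ∀ i j, Measurable fun a => f a i j := by
  refine measurable_pi_iff.trans (forall_congr' fun i => measurable_pi_iff)

theorem measurable_matrix_apply {m n : ℕ} (i : Fin m) (j : Fin n) :
    Measurable fun M : Matrix (Fin m) (Fin n) ℂ => M i j :=
  measurable_matrix_iff.1 measurable_id i j

theorem lintegral_fin_cons {E : Type*} [MeasureSpace E] [SigmaFinite (volume : Measure E)] {n : ℕ}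
    {F : (Fin (n + 1) → E) → ENNReal} (hF : Measurable F) :
    ∫⁻ X, F X = ∫⁻ x : E, ∫⁻ Y : Fin n → E, F (Fin.cons x Y) := by
  have h := (volume_preserving_piFinSuccAbove (fun _ : Fin (n + 1) => E) 0).symm
  rw [← h.lintegral_comp hF]
  refine (lintegral_prod _ (hF.comp h.measurable).aemeasurable).trans ?_
  simp [MeasurableEquiv.piFinSuccAbove, Fin.insertNthEquiv]

theorem lintegral_fin_cons_col {n p : ℕ} {F : (Fin n → Fin (p + 1) → ℂ) → ENNReal}
    (hF : Measurable F) :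
    ∫⁻ X, F X = ∫⁻ x : Fin n → ℂ, ∫⁻ Y : Fin n → Fin p → ℂ, F (fun i => Fin.cons (x i) (Y i)) := by
  have h1 := (volume_preserving_piFinSuccAbove (fun _ : Fin (p + 1) => ℂ) 0).symm
  have h2 := volume_preserving_pi (fun _ : Fin n => h1)
  have h3 := (volume_measurePreserving_arrowProdEquivProdArrow ℂ (Fin p → ℂ) (Fin n)).symm
  have h := h2.comp h3
  rw [← h.lintegral_comp hF]
  refine (lintegral_prod _ (hF.comp h.measurable).aemeasurable).trans ?_
  simp [MeasurableEquiv.piFinSuccAbove, Fin.insertNthEquiv,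
    MeasurableEquiv.arrowProdEquivProdArrow, Equiv.arrowProdEquivProdArrow]

theorem lintegral_comp_sqrt_smul {p : ℕ} {s : ℝ} (hs : 0 < s) {g : (Fin p → ℂ) → ENNReal}
    (hg : Measurable g) :
    ENNReal.ofReal (s ^ p) * ∫⁻ y, g (Real.sqrt s • y) = ∫⁻ v, g v := by
  have hr : Real.sqrt s ≠ 0 := (Real.sqrt_pos.2 hs).ne'
  have h := Measure.map_addHaar_smul (volume : Measure (Fin p → ℂ)) hr
  rw [← lintegral_map hg (measurable_const_smul (Real.sqrt s)), h, lintegral_smul_measure,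
    smul_eq_mul, ← mul_assoc, ← ENNReal.ofReal_mul (by positivity)]
  have h1 : Module.finrank ℝ (Fin p → ℂ) = 2 * p := by
    simp [Module.finrank_pi_fintype, mul_comm]
  rw [h1, pow_mul, Real.sq_sqrt hs.le, abs_of_pos (by positivity), mul_inv_cancel₀ (by positivity)]
  simp

/-- The strictly upper triangular positions of size `p + 1`: the first row, and those of size
`p`. -/
noncomputable def upperIndexEquiv (p : ℕ) :
    Fin p ⊕ { q : Fin p × Fin p // q.1 < q.2 } ≃ { q : Fin (p + 1) × Fin (p + 1) // q.1 < q.2 } :=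
  Equiv.ofBijective
    (Sum.elim (fun j => ⟨(0, j.succ), Fin.succ_pos j⟩)
      fun q => ⟨(q.1.1.succ, q.1.2.succ), Fin.succ_lt_succ_iff.2 q.2⟩) <| by
    constructor
    · rintro (i | ⟨⟨i, j⟩, h⟩) (i' | ⟨⟨i', j'⟩, h'⟩) <;> simp [eq_comm]
    · rintro ⟨⟨i, j⟩, h⟩
      obtain ⟨j, rfl⟩ := Fin.exists_succ_eq.2 (Fin.ne_zero_of_lt h)
      rcases Fin.eq_zero_or_eq_succ i with rfl | ⟨i, rfl⟩
      · exact ⟨.inl j, rfl⟩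
      · exact ⟨.inr ⟨(i, j), Fin.succ_lt_succ_iff.1 h⟩, rfl⟩

@[simp]
theorem upperIndexEquiv_inl {p : ℕ} (j : Fin p) :
    upperIndexEquiv p (.inl j) = ⟨(0, j.succ), Fin.succ_pos j⟩ := rfl

@[simp]
theorem upperIndexEquiv_inr {p : ℕ} (q : { q : Fin p × Fin p // q.1 < q.2 }) :
    upperIndexEquiv p (.inr q) = ⟨(q.1.1.succ, q.1.2.succ), Fin.succ_lt_succ_iff.2 q.2⟩ := rfl

theorem measurable_toHermMatrix (p : ℕ) : Measurable (toHermMatrix p) := by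
  refine measurable_matrix_iff.2 fun i j => ?_
  simp only [toHermMatrix, Matrix.of_apply]
  split_ifs
  · fun_prop
  · exact Complex.continuous_conj.measurable.comp (by fun_prop)
  · fun_prop

theorem measurable_borderedMatrix {α : Type*} [MeasurableSpace α] {p : ℕ} {s : α → ℝ}
    {v : α → Fin p → ℂ} {W : α → Matrix (Fin p) (Fin p) ℂ} (hs : Measurable s) (hv : Measurable v)
    (hW : Measurable W) : Measurable fun a => borderedMatrix (s a) (v a) (W a) := by
  refine measurable_matrix_iff.2 fun i j => ?_
  refine Fin.cases ?_ (fun i => ?_) i <;> refine Fin.cases ?_ (fun j => ?_) j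
  · exact Complex.measurable_ofReal.comp hs
  · exact measurable_pi_iff.1 hv j
  · exact Complex.continuous_conj.measurable.comp (measurable_pi_iff.1 hv i)
  · exact measurable_matrix_iff.1 hW i j

theorem toHermMatrix_succ {p : ℕ} (s : ℝ) (d : Fin p → ℝ)
    (u : { q : Fin (p + 1) × Fin (p + 1) // q.1 < q.2 } → ℂ) :
    toHermMatrix (p + 1) (Fin.cons s d, u) =
      borderedMatrix s (fun j => u (upperIndexEquiv p (.inl j)))
        (toHermMatrix p (d, fun q => u (upperIndexEquiv p (.inr q)))) := by
  ext i j
  refine Fin.cases ?_ (fun i => ?_) i <;> refine Fin.cases ?_ (fun j => ?_) j <;>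
    simp [toHermMatrix]

theorem lintegral_toHermMatrix_succ {p : ℕ}
    {F : Matrix (Fin (p + 1)) (Fin (p + 1)) ℂ → ENNReal} (hF : Measurable F) :
    ∫⁻ T, F (toHermMatrix (p + 1) T) =
      ∫⁻ s : ℝ, ∫⁻ v : Fin p → ℂ, ∫⁻ T, F (borderedMatrix s v (toHermMatrix p T)) := by
  have hG : Measurable fun T => F (toHermMatrix (p + 1) T) := hF.comp (measurable_toHermMatrix _)
  refine (lintegral_prod _ hG.aemeasurable).trans ?_
  rw [lintegral_fin_cons hG.lintegral_prod_right']
  refine lintegral_congr fun s => ?_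
  have h := (volume_measurePreserving_piCongrLeft (fun _ => ℂ) (upperIndexEquiv p)).comp
    (volume_measurePreserving_sumPiEquivProdPi_symm (fun _ => ℂ))
  have hB : Measurable fun z : (Fin p → ℝ) × (Fin p → ℂ) × ({ q : Fin p × Fin p // q.1 < q.2 } → ℂ) =>
      F (borderedMatrix s z.2.1 (toHermMatrix p (z.1, z.2.2))) :=
    hF.comp (measurable_borderedMatrix measurable_const (by fun_prop)
      ((measurable_toHermMatrix p).comp (by fun_prop)))
  have hinner (d : Fin p → ℝ) :
      ∫⁻ u : { q : Fin (p + 1) × Fin (p + 1) // q.1 < q.2 } → ℂ,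
        F (toHermMatrix (p + 1) (Fin.cons s d, u)) =
      ∫⁻ v : Fin p → ℂ, ∫⁻ u : { q : Fin p × Fin p // q.1 < q.2 } → ℂ,
        F (borderedMatrix s v (toHermMatrix p (d, u))) := by
    have hm : Measurable fun u : { q : Fin (p + 1) × Fin (p + 1) // q.1 < q.2 } → ℂ =>
        F (toHermMatrix (p + 1) (Fin.cons s d, u)) :=
      hG.comp measurable_prodMk_left
    rw [← h.lintegral_comp hm]
    refine (lintegral_prod _ (hm.comp h.measurable).aemeasurable).trans ?_
    refine lintegral_congr fun v => lintegral_congr fun u => ?_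
    rw [Function.comp_apply, Function.comp_apply, toHermMatrix_succ]
    have h1 (k) : MeasurableEquiv.piCongrLeft (fun _ => ℂ) (upperIndexEquiv p)
        ((MeasurableEquiv.sumPiEquivProdPi fun _ => ℂ).symm (v, u)) (upperIndexEquiv p k) =
        (Sum.elim v u k : ℂ) := by
      rw [MeasurableEquiv.piCongrLeft_apply_apply]
      cases k <;> rfl
    simp only [h1, Sum.elim_inl, Sum.elim_inr]
  simp only [hinner]
  rw [lintegral_lintegral_swap]
  · refine lintegral_congr fun v => ?_
    refine (lintegral_prod (fun T : HermParam p => F (borderedMatrix s v (toHermMatrix p T)))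
      (Measurable.aemeasurable ?_)).symm
    exact hB.comp (by fun_prop : Measurable fun T : HermParam p => (T.1, v, T.2))
  · refine Measurable.aemeasurable ?_
    refine Measurable.lintegral_prod_right'
      (f := fun z : ((Fin p → ℝ) × (Fin p → ℂ)) × ({ q : Fin p × Fin p // q.1 < q.2 } → ℂ) =>
        F (borderedMatrix s z.1.2 (toHermMatrix p (z.1.1, z.2)))) ?_
    exact hB.comp (MeasurableEquiv.prodAssoc.measurable)

theorem exists_toHermMatrix_eq {p : ℕ} {M : Matrix (Fin p) (Fin p) ℂ} (hM : M.IsHermitian) :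
    ∃ T, toHermMatrix p T = M := by
  refine ⟨(fun i => (M i i).re, fun q => M q.1.1 q.1.2), ?_⟩
  ext i j
  rw [← hM.apply i j]
  rcases lt_trichotomy i j with h | rfl | h
  · simp [toHermMatrix, h, hM.apply]
  · simpa [toHermMatrix, hM.apply] using hM.coe_re_apply_self i
  · simp [toHermMatrix, h, h.not_gt]

theorem toHermMatrix_add {p : ℕ} (T T' : HermParam p) :
    toHermMatrix p (T + T') = toHermMatrix p T + toHermMatrix p T' := by
  ext i j
  simp only [toHermMatrix, Matrix.of_apply, Matrix.add_apply]
  split_ifs <;> simp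

theorem lintegral_add_toHermMatrix {p : ℕ} {M : Matrix (Fin p) (Fin p) ℂ} (hM : M.IsHermitian)
    (F : Matrix (Fin p) (Fin p) ℂ → ENNReal) :
    ∫⁻ T, F (M + toHermMatrix p T) = ∫⁻ T, F (toHermMatrix p T) := by
  obtain ⟨T₀, rfl⟩ := exists_toHermMatrix_eq hM
  simp only [← toHermMatrix_add]
  have : (volume : Measure (HermParam p)).IsAddLeftInvariant :=
    Measure.prod.instIsAddLeftInvariant
  exact lintegral_add_left_eq_self (fun T => F (toHermMatrix p T)) T₀

theorem measurable_matrix_det (p : ℕ) : Measurable fun S : Matrix (Fin p) (Fin p) ℂ => S.det := by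
  simp only [Matrix.det_apply]
  refine Finset.measurable_sum _ fun σ _ => ?_
  exact (Finset.measurable_prod _ fun i _ => measurable_matrix_apply _ _).const_smul _

theorem measurableSet_posDef (p : ℕ) :
    MeasurableSet {S : Matrix (Fin p) (Fin p) ℂ | S.PosDef} := by
  have hq (x : Fin p → ℂ) : Continuous fun S : Matrix (Fin p) (Fin p) ℂ => star x ⬝ᵥ S *ᵥ x := by
    fun_prop
  have hclosed : IsClosed {S : Matrix (Fin p) (Fin p) ℂ | S.PosSemidef} := by
    simp only [Matrix.posSemidef_iff_dotProduct_mulVec, Set.ofPred_and, Set.ofPred_forall]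
    refine IsClosed.inter ?_ (isClosed_iInter fun x => ?_)
    · exact isClosed_eq (by fun_prop) continuous_id
    · exact isClosed_le continuous_const (hq x)
  have h1 : MeasurableSet {S : Matrix (Fin p) (Fin p) ℂ | S.PosSemidef} :=
    @IsClosed.measurableSet (Fin p → Fin p → ℂ) _ _ _ _ hclosed
  have h2 : {S : Matrix (Fin p) (Fin p) ℂ | S.PosDef} =
      {S | S.PosSemidef} ∩ (fun S => S.det) ⁻¹' {0}ᶜ := by
    ext S
    refine ⟨fun h => ⟨h.posSemidef, h.det_pos.ne'⟩, fun h => ?_⟩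
    exact (Matrix.PosSemidef.posDef_iff_isUnit h.1).2
      ((Matrix.isUnit_iff_isUnit_det S).2 (isUnit_iff_ne_zero.2 h.2))
  rw [h2]
  exact h1.inter (measurable_matrix_det p (measurableSet_singleton 0).compl)

/-- The function `S ↦ det(S)^k` on the positive definite cone, extended by zero. -/
noncomputable def detPowWeight (p k : ℕ) : Matrix (Fin p) (Fin p) ℂ → ENNReal :=
  {S : Matrix (Fin p) (Fin p) ℂ | S.PosDef}.indicator fun S => ENNReal.ofReal (S.det.re ^ k)

theorem measurable_detPowWeight (p k : ℕ) : Measurable (detPowWeight p k) := by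
  refine Measurable.indicator ?_ (measurableSet_posDef p)
  exact ((Complex.measurable_re.comp (measurable_matrix_det p)).pow_const k).ennreal_ofReal

theorem detPowWeight_borderedMatrix {p : ℕ} (k : ℕ) {s : ℝ} (hs : 0 < s) (v : Fin p → ℂ)
    (W : Matrix (Fin p) (Fin p) ℂ) :
    detPowWeight (p + 1) k (borderedMatrix s v (s⁻¹ • rankOne v + W)) =
      ENNReal.ofReal (s ^ k) * detPowWeight p k W := by
  by_cases hW : W.PosDef
  · rw [detPowWeight, detPowWeight, Set.indicator_of_mem, Set.indicator_of_mem,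
      det_borderedMatrix hs.ne', Complex.re_ofReal_mul, mul_pow, ENNReal.ofReal_mul (by positivity)]
    · exact hW
    · exact (posDef_borderedMatrix hs v W).2 hW
  · rw [detPowWeight, detPowWeight, Set.indicator_of_notMem, Set.indicator_of_notMem, mul_zero]
    · exact hW
    · exact fun h => hW ((posDef_borderedMatrix hs v W).1 h)

theorem detPowWeight_borderedMatrix_of_nonpos {p : ℕ} (k : ℕ) {s : ℝ} (hs : s ≤ 0)
    (v : Fin p → ℂ) (W : Matrix (Fin p) (Fin p) ℂ) :
    detPowWeight (p + 1) k (borderedMatrix s v W) = 0 := by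
  refine Set.indicator_of_notMem (fun h => ?_) _
  have := Matrix.PosDef.diag_pos h (i := 0)
  rw [borderedMatrix_zero_zero] at this
  exact hs.not_gt (by exact_mod_cast this)

theorem isHermitian_smul_rankOne {p : ℕ} (s : ℝ) (v : Fin p → ℂ) :
    (s • rankOne v).IsHermitian := by
  ext i j
  simp [rankOne, mul_comm]

theorem inv_smul_rankOne_sqrt_smul {p : ℕ} {s : ℝ} (hs : 0 < s) (y : Fin p → ℂ) :
    s⁻¹ • rankOne (Real.sqrt s • y) = rankOne y := by
  ext i j
  have h1 : ((Real.sqrt s : ℝ) : ℂ) * (Real.sqrt s : ℝ) = s := by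
    rw [← Complex.ofReal_mul, Real.mul_self_sqrt hs.le]
  have h2 : (s : ℂ) ≠ 0 := by exact_mod_cast hs.ne'
  simp only [rankOne, Matrix.smul_apply, Matrix.of_apply, Pi.smul_apply, Complex.real_smul,
    star_mul', RCLike.star_def, Complex.conj_ofReal, Complex.ofReal_inv]
  field_simp
  linear_combination (starRingEnd ℂ (y i) * y j) * h1

theorem measurable_rankOne (p : ℕ) : Measurable (rankOne (p := p)) := by
  refine measurable_matrix_iff.2 fun i j => ?_
  exact (Complex.continuous_conj.measurable.comp (measurable_pi_apply i)).mul (measurable_pi_apply j)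

theorem measurable_matrix_add {α : Type*} [MeasurableSpace α] {m n : ℕ}
    {A B : α → Matrix (Fin m) (Fin n) ℂ} (hA : Measurable A) (hB : Measurable B) :
    Measurable fun a => A a + B a :=
  measurable_matrix_iff.2 fun i j =>
    (measurable_matrix_iff.1 hA i j).add (measurable_matrix_iff.1 hB i j)

theorem measurable_matrix_smul {α : Type*} [MeasurableSpace α] {m n : ℕ} {c : α → ℝ}
    {A : α → Matrix (Fin m) (Fin n) ℂ} (hc : Measurable c) (hA : Measurable A) :
    Measurable fun a => c a • A a :=
  measurable_matrix_iff.2 fun i j => hc.smul (measurable_matrix_iff.1 hA i j)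

theorem measurable_conjTranspose_mul_self (n p : ℕ) :
    Measurable fun X : Matrix (Fin n) (Fin p) ℂ => Xᴴ * X := by
  refine measurable_matrix_iff.2 fun i j => ?_
  simp only [Matrix.mul_apply, Matrix.conjTranspose_apply]
  exact Finset.measurable_sum _ fun k _ =>
    (Complex.continuous_conj.measurable.comp (measurable_matrix_apply k i)).mul
      (measurable_matrix_apply k j)

theorem rGammaP_succ (p : ℕ) (n : ℕ) :
    rGammaP (p + 1) ((n + 1 : ℕ) : ℝ) = Real.pi ^ p * (n.factorial * rGammaP p n) := by
  have h1 : (p + 1) * (p + 1 - 1) / 2 = p + p * (p - 1) / 2 := by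
    rw [Nat.triangle_succ, add_comm]
  rw [rGammaP, rGammaP, h1, pow_add, Fin.prod_univ_succ]
  have h2 : Real.Gamma (((n + 1 : ℕ) : ℝ) - ((0 : Fin (p + 1)) : ℕ)) = n.factorial := by
    rw [← Real.Gamma_nat_eq_factorial]; simp
  rw [h2]
  simp only [Fin.val_succ, Nat.cast_add, Nat.cast_one, add_sub_add_right_eq_sub]
  ring

theorem ofReal_pi_pow_div_rGammaP_succ (p n : ℕ) :
    ENNReal.ofReal (Real.pi ^ (n + 1) / n.factorial) *
        ENNReal.ofReal (Real.pi ^ (n * p) / rGammaP p n) =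
      ENNReal.ofReal (Real.pi ^ ((n + 1) * (p + 1)) / rGammaP (p + 1) ((n + 1 : ℕ) : ℝ)) := by
  rw [← ENNReal.ofReal_mul (by positivity), rGammaP_succ, div_mul_div_comm,
    ← mul_div_mul_left _ _ (pow_ne_zero p Real.pi_ne_zero)]
  congr 2
  ring

theorem lintegral_conjTranspose_mul_col {n p : ℕ} (x : Fin (n + 1) → ℂ)
    {f : Matrix (Fin (p + 1)) (Fin (p + 1)) ℂ → ENNReal} (hf : Measurable f) :
    ∫⁻ Y : Fin (n + 1) → Fin p → ℂ,
        f (borderedMatrix (∑ i, ‖x i‖ ^ 2) (star x ᵥ* Matrix.of Y) ((Matrix.of Y)ᴴ * Matrix.of Y)) =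
      ∫⁻ y : Fin p → ℂ, ∫⁻ Z : Fin n → Fin p → ℂ,
        f (borderedMatrix (∑ i, ‖x i‖ ^ 2) (Real.sqrt (∑ i, ‖x i‖ ^ 2) • y)
          (rankOne y + (Matrix.of Z)ᴴ * Matrix.of Z)) := by
  obtain ⟨U, hU, hx⟩ := exists_unitary_mulVec_single n x
  have hm : Measurable fun Y : Fin (n + 1) → Fin p → ℂ =>
      f (borderedMatrix (∑ i, ‖x i‖ ^ 2) (star x ᵥ* Matrix.of Y)
        ((Matrix.of Y)ᴴ * Matrix.of Y)) := by
    refine hf.comp (measurable_borderedMatrix measurable_const ?_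
      (measurable_conjTranspose_mul_self (n + 1) p))
    refine measurable_pi_iff.2 fun j => ?_
    simp only [Matrix.vecMul, dotProduct, Matrix.of_apply]
    fun_prop
  have hP := measurePreserving_unitary_mul (p := p) hU
  refine (hP.lintegral_comp hm).symm.trans ?_
  refine (lintegral_fin_cons (hm.comp hP.measurable)).trans ?_
  exact lintegral_congr fun y => lintegral_congr fun Z =>
    congrArg f (conjTranspose_mul_cons_col_unitary hU hx y Z)

theorem lintegral_detPowWeight_mul_bordered {p : ℕ} (k : ℕ) {s : ℝ} (hs : 0 < s)
    {f : Matrix (Fin (p + 1)) (Fin (p + 1)) ℂ → ENNReal} (hf : Measurable f) :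
    ENNReal.ofReal (s ^ (k + p)) * ∫⁻ y : Fin p → ℂ, ∫⁻ T, detPowWeight p k (toHermMatrix p T) *
        f (borderedMatrix s (Real.sqrt s • y) (rankOne y + toHermMatrix p T)) =
      ∫⁻ v : Fin p → ℂ, ∫⁻ T, detPowWeight (p + 1) k (borderedMatrix s v (toHermMatrix p T)) *
        f (borderedMatrix s v (toHermMatrix p T)) := by
  have hm : Measurable fun z : (Fin p → ℂ) × HermParam p => detPowWeight p k (toHermMatrix p z.2) *
      f (borderedMatrix s z.1 (s⁻¹ • rankOne z.1 + toHermMatrix p z.2)) :=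
    ((measurable_detPowWeight p k).comp ((measurable_toHermMatrix p).comp measurable_snd)).mul
      (hf.comp (measurable_borderedMatrix measurable_const measurable_fst
        (measurable_matrix_add (measurable_matrix_smul measurable_const
          ((measurable_rankOne p).comp measurable_fst))
          ((measurable_toHermMatrix p).comp measurable_snd))))
  have hsc := lintegral_comp_sqrt_smul hs (hm.lintegral_prod_right' (ν := volume))
  simp only [inv_smul_rankOne_sqrt_smul hs] at hsc
  rw [pow_add, ENNReal.ofReal_mul (by positivity), mul_assoc, hsc,
    ← lintegral_const_mul' _ _ ENNReal.ofReal_ne_top]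
  refine lintegral_congr fun v => ?_
  rw [← lintegral_const_mul' _ _ ENNReal.ofReal_ne_top,
    ← lintegral_add_toHermMatrix (isHermitian_smul_rankOne s⁻¹ v)
      (fun W => detPowWeight (p + 1) k (borderedMatrix s v W) * f (borderedMatrix s v W))]
  refine lintegral_congr fun T => ?_
  rw [detPowWeight_borderedMatrix k hs, mul_assoc]

theorem lintegral_conjTranspose_mul_self {n p : ℕ} (hnp : p ≤ n)
    {f : Matrix (Fin p) (Fin p) ℂ → ENNReal} (hf : Measurable f) :
    ∫⁻ X : Fin n → Fin p → ℂ, f ((Matrix.of X)ᴴ * Matrix.of X) =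
      ENNReal.ofReal (Real.pi ^ (n * p) / rGammaP p n) *
        ∫⁻ T, detPowWeight p (n - p) (toHermMatrix p T) * f (toHermMatrix p T) := by
  induction p generalizing n with
  | zero =>
    have hw (S : Matrix (Fin 0) (Fin 0) ℂ) : detPowWeight 0 n S = 1 := by
      have hS : S.PosDef := .of_dotProduct_mulVec_pos (Subsingleton.elim _ _)
        fun x hx => (hx (Subsingleton.elim _ _)).elim
      rw [detPowWeight, Set.indicator_of_mem (show S ∈ {S | S.PosDef} from hS)]
      simp
    have hv : (volume : Measure (Fin n → Fin 0 → ℂ)) Set.univ = 1 := by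
      simp [volume_pi, Measure.pi_univ]
    have hv' : (volume : Measure (HermParam 0)) Set.univ = 1 := by
      rw [← Set.univ_prod_univ]
      refine (Measure.prod_prod _ _).trans ?_
      simp [volume_pi]
    have hc (S : Matrix (Fin 0) (Fin 0) ℂ) : f S = f 0 := congrArg f (Subsingleton.elim _ _)
    simp only [Nat.sub_zero, hw, one_mul, hc, lintegral_const, hv, hv']
    simp [rGammaP]
  | succ p ih =>
    obtain ⟨n, rfl⟩ : ∃ m, n = m + 1 := ⟨n - 1, by omega⟩
    have hpn : p ≤ n := by omega
    have hbm : Measurable fun z : (ℝ × (Fin p → ℂ)) × Matrix (Fin p) (Fin p) ℂ =>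
        f (borderedMatrix z.1.1 (Real.sqrt z.1.1 • z.1.2) (rankOne z.1.2 + z.2)) := by
      refine hf.comp (measurable_borderedMatrix (by fun_prop) (by fun_prop)
        (measurable_matrix_add ((measurable_rankOne p).comp (by fun_prop)) measurable_snd))
    have hg : Measurable fun s : ℝ => ∫⁻ y : Fin p → ℂ, ∫⁻ T,
        detPowWeight p (n - p) (toHermMatrix p T) *
          f (borderedMatrix s (Real.sqrt s • y) (rankOne y + toHermMatrix p T)) := by
      have h1 : Measurable fun z : (ℝ × (Fin p → ℂ)) × HermParam p =>
          detPowWeight p (n - p) (toHermMatrix p z.2) * f (borderedMatrix z.1.1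
            (Real.sqrt z.1.1 • z.1.2) (rankOne z.1.2 + toHermMatrix p z.2)) :=
        ((measurable_detPowWeight p _).comp ((measurable_toHermMatrix p).comp measurable_snd)).mul
          (hbm.comp (measurable_fst.prodMk ((measurable_toHermMatrix p).comp measurable_snd)))
      exact h1.lintegral_prod_right'.lintegral_prod_right'
    have hG : Measurable fun X : Fin (n + 1) → Fin (p + 1) → ℂ =>
        f ((Matrix.of X)ᴴ * Matrix.of X) :=
      hf.comp (measurable_conjTranspose_mul_self (n + 1) (p + 1))
    have hF : Measurable fun S : Matrix (Fin (p + 1)) (Fin (p + 1)) ℂ =>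
        detPowWeight (p + 1) (n - p) S * f S := (measurable_detPowWeight _ _).mul hf
    calc ∫⁻ X : Fin (n + 1) → Fin (p + 1) → ℂ, f ((Matrix.of X)ᴴ * Matrix.of X)
      _ = ∫⁻ x : Fin (n + 1) → ℂ, ENNReal.ofReal (Real.pi ^ (n * p) / rGammaP p n) *
            ∫⁻ y : Fin p → ℂ, ∫⁻ T, detPowWeight p (n - p) (toHermMatrix p T) *
              f (borderedMatrix (∑ i, ‖x i‖ ^ 2) (Real.sqrt (∑ i, ‖x i‖ ^ 2) • y)
                (rankOne y + toHermMatrix p T)) := by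
        rw [lintegral_fin_cons_col hG]
        refine lintegral_congr fun x => ?_
        simp only [conjTranspose_mul_cons_col]
        rw [lintegral_conjTranspose_mul_col x hf, ← lintegral_const_mul' _ _ ENNReal.ofReal_ne_top]
        exact lintegral_congr fun y => ih hpn (hbm.comp (measurable_prodMk_left
          (x := ((∑ i, ‖x i‖ ^ 2 : ℝ), y))))
      _ = ENNReal.ofReal (Real.pi ^ ((n + 1) * (p + 1)) / rGammaP (p + 1) ((n + 1 : ℕ) : ℝ)) *
            ∫⁻ s in Set.Ioi (0 : ℝ), ENNReal.ofReal (s ^ n) *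
              ∫⁻ y : Fin p → ℂ, ∫⁻ T, detPowWeight p (n - p) (toHermMatrix p T) *
                f (borderedMatrix s (Real.sqrt s • y) (rankOne y + toHermMatrix p T)) := by
        rw [lintegral_const_mul' _ _ ENNReal.ofReal_ne_top, lintegral_comp_sum_norm_sq n hg,
          ← mul_assoc, mul_comm (ENNReal.ofReal _), ofReal_pi_pow_div_rGammaP_succ]
      _ = ENNReal.ofReal (Real.pi ^ ((n + 1) * (p + 1)) / rGammaP (p + 1) ((n + 1 : ℕ) : ℝ)) *
            ∫⁻ s : ℝ, ∫⁻ v : Fin p → ℂ, ∫⁻ T,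
              detPowWeight (p + 1) (n - p) (borderedMatrix s v (toHermMatrix p T)) *
                f (borderedMatrix s v (toHermMatrix p T)) := by
        congr 1
        rw [← lintegral_indicator measurableSet_Ioi]
        refine lintegral_congr fun s => ?_
        rcases lt_or_ge 0 s with hs | hs
        · rw [Set.indicator_of_mem (Set.mem_Ioi.2 hs), ← lintegral_detPowWeight_mul_bordered (n - p) hs hf,
            Nat.sub_add_cancel hpn]
        · rw [Set.indicator_of_notMem (by simpa using hs)]
          simp [detPowWeight_borderedMatrix_of_nonpos _ hs]
      _ = _ := by
        rw [Nat.add_sub_add_right, lintegral_toHermMatrix_succ hF]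

theorem stmt5 (n p : ℕ) (hp : 1 ≤ p) (hnp : p ≤ n) :
    Measure.map (fun X : Matrix (Fin n) (Fin p) ℂ => Xᴴ * X)
      (volume : Measure (Matrix (Fin n) (Fin p) ℂ)) =
    (hermLebesgue p).withDensity
      ({S : Matrix (Fin p) (Fin p) ℂ | S.PosDef}.indicator fun S =>
        ENNReal.ofReal (Real.pi ^ (n * p) / rGammaP p n * S.det.re ^ (n - p))) := by
  ext A hA
  have hw : ({S : Matrix (Fin p) (Fin p) ℂ | S.PosDef}.indicator fun S =>
      ENNReal.ofReal (Real.pi ^ (n * p) / rGammaP p n * S.det.re ^ (n - p))) =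
      fun S => ENNReal.ofReal (Real.pi ^ (n * p) / rGammaP p n) * detPowWeight p (n - p) S := by
    ext S
    by_cases hS : S ∈ {S : Matrix (Fin p) (Fin p) ℂ | S.PosDef}
    · rw [detPowWeight, Set.indicator_of_mem hS, Set.indicator_of_mem hS, ENNReal.ofReal_mul']
      exact pow_nonneg (Complex.pos_iff.1 (Matrix.PosDef.det_pos hS)).1.le _
    · rw [detPowWeight, Set.indicator_of_notMem hS, Set.indicator_of_notMem hS, mul_zero]
  have hd := measurable_detPowWeight p (n - p)
  have hI : Measurable (A.indicator (1 : Matrix (Fin p) (Fin p) ℂ → ENNReal)) :=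
    measurable_one.indicator hA
  rw [hw, ← lintegral_indicator_one hA, ← lintegral_indicator_one hA,
    lintegral_map hI (measurable_conjTranspose_mul_self n p),
    lintegral_withDensity_eq_lintegral_mul _ (hd.const_mul _) hI, hermLebesgue,
    lintegral_map ((hd.const_mul _).mul hI) (measurable_toHermMatrix p)]
  refine (lintegral_conjTranspose_mul_self hnp hI).trans ?_
  simp only [Pi.mul_apply, mul_assoc]
  rw [lintegral_const_mul' _ _ ENNReal.ofReal_ne_top]
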